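/- Let (Ω, ℱ, P) be a probability space, K and L positive integers, ỹ : Ω → EuclideanSpace ℝ (Fin L) measurable with every component ỹ_l(ω) ∈ [0,1], a : Ω → Fin K measurable with P(a = k) > 0 for every k ∈ Fin K, and y : Ω → Finset (Fin L) measurable. Let y_adv be a nonempty Finset of Fin L. For γ > 0 set s_γ(ω) = exp(γ·(Jac(y(ω), y_adv) − 1)), and let ℓ(γ) be the s_γ-SimFair violation Σ_{k} ‖ (∫ s_γ • ỹ dP)/(∫ s_γ dP) − (∫ 1{a = k}·s_γ • ỹ dP)/(∫ 1{a = k}·s_γ dP) ‖. If there exists a sequence of positive reals γ_n → 0 with ℓ(γ_n) = 0 for all n, then the Demographic Parity violation is zero: for every k ∈ Fin K, ∫ ỹ dP = (∫ 1{a = k} • ỹ dP)/P(a = k). -/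

import Mathlib

open MeasureTheory

/-- The Jaccard score between two finsets with nonempty union. -/
noncomputable def jaccard {α : Type*} [DecidableEq α] (A B : Finset α) : ℝ :=
  ((A ∩ B).card : ℝ) / ((A ∪ B).card : ℝ)

/-- The similarity `s_γ(A, B) = exp(γ·(Jac(A, B) − 1))`. -/
noncomputable def simil {α : Type*} [DecidableEq α] (γ : ℝ) (A B : Finset α) : ℝ :=
  Real.exp (γ * (jaccard A B - 1))

/-- The `s`-weighted fairness violation
`Σ_k ‖ (∫ s • ytil dP)/(∫ s dP) − (∫ 1{a = k}·s • ytil dP)/(∫ 1{a = k}·s dP) ‖`. -/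
noncomputable def fairViolation {Ω : Type*} [MeasurableSpace Ω] (P : Measure Ω)
    {K L : ℕ} (ytil : Ω → EuclideanSpace ℝ (Fin L)) (a : Ω → Fin K) (s : Ω → ℝ) : ℝ :=
  ∑ k : Fin K,
    ‖(∫ ω, s ω ∂P)⁻¹ • (∫ ω, s ω • ytil ω ∂P)
      - (∫ ω in {ω | a ω = k}, s ω ∂P)⁻¹ • (∫ ω in {ω | a ω = k}, s ω • ytil ω ∂P)‖

theorem jaccard_le_one {α : Type*} [DecidableEq α] (A B : Finset α) : jaccard A B ≤ 1 :=
  div_le_one_of_le₀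
    (by exact_mod_cast Finset.card_le_card (Finset.inter_subset_left.trans Finset.subset_union_left))
    (Nat.cast_nonneg _)

theorem simil_pos {α : Type*} [DecidableEq α] (γ : ℝ) (A B : Finset α) : 0 < simil γ A B :=
  Real.exp_pos _

theorem simil_le_one {α : Type*} [DecidableEq α] {γ : ℝ} (hγ : 0 ≤ γ) (A B : Finset α) :
    simil γ A B ≤ 1 :=
  Real.exp_le_one_iff.2 (mul_nonpos_of_nonneg_of_nonpos hγ (sub_nonpos.2 (jaccard_le_one A B)))

theorem measurable_simil {Ω α : Type*} [MeasurableSpace Ω] [Fintype α] [DecidableEq α]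
    {y : Ω → Finset α} (hy : ∀ S, MeasurableSet {ω | y ω = S}) (γ : ℝ) (B : Finset α) :
    Measurable fun ω => simil γ (y ω) B := by
  let _ : MeasurableSpace (Finset α) := ⊤
  have hy' : Measurable y := measurable_to_countable' hy
  exact (measurable_from_top (f := fun A => simil γ A B)).comp hy'

/-- As the temperature tends to zero, similarity-weighted integrals tend to unweighted ones. -/
theorem tendsto_integral_simil_smul {Ω α E : Type*} [MeasurableSpace Ω] [Fintype α]
    [DecidableEq α] [NormedAddCommGroup E] [NormedSpace ℝ E] {μ : Measure Ω}
    {y : Ω → Finset α} (hy : ∀ S, MeasurableSet {ω | y ω = S}) (B : Finset α)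
    {γ : ℕ → ℝ} (hγpos : ∀ n, 0 ≤ γ n) (hγ : Filter.Tendsto γ Filter.atTop (nhds 0))
    {f : Ω → E} (hf : Integrable f μ) :
    Filter.Tendsto (fun n => ∫ ω, simil (γ n) (y ω) B • f ω ∂μ) Filter.atTop
      (nhds (∫ ω, f ω ∂μ)) := by
  refine tendsto_integral_of_dominated_convergence (fun ω => ‖f ω‖)
    (fun n => (measurable_simil hy (γ n) B).aestronglyMeasurable.smul hf.1) hf.norm
    (fun n => .of_forall fun ω => ?_) (.of_forall fun ω => ?_)
  · rw [norm_smul, Real.norm_of_nonneg (simil_pos _ _ _).le]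
    exact mul_le_of_le_one_left (norm_nonneg _) (simil_le_one (hγpos n) _ _)
  · have h : Filter.Tendsto (fun n => simil (γ n) (y ω) B) Filter.atTop (nhds 1) := by
      have := (Real.continuous_exp.tendsto _).comp (hγ.mul_const (jaccard (y ω) B - 1))
      simpa [simil, Function.comp_def] using this
    simpa using h.smul_const (f ω)

/-- As the temperature tends to zero, similarity-weighted means tend to the ordinary mean. -/
theorem tendsto_simil_weighted_mean {Ω α E : Type*} [MeasurableSpace Ω] [Fintype α]
    [DecidableEq α] [NormedAddCommGroup E] [NormedSpace ℝ E] {μ : Measure Ω} [IsFiniteMeasure μ]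
    (hμ : μ ≠ 0) {y : Ω → Finset α} (hy : ∀ S, MeasurableSet {ω | y ω = S}) (B : Finset α)
    {γ : ℕ → ℝ} (hγpos : ∀ n, 0 ≤ γ n) (hγ : Filter.Tendsto γ Filter.atTop (nhds 0))
    {f : Ω → E} (hf : Integrable f μ) :
    Filter.Tendsto
      (fun n => (∫ ω, simil (γ n) (y ω) B ∂μ)⁻¹ • ∫ ω, simil (γ n) (y ω) B • f ω ∂μ)
      Filter.atTop (nhds ((μ Set.univ).toReal⁻¹ • ∫ ω, f ω ∂μ)) := by
  have hpos : (μ Set.univ).toReal ≠ 0 :=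
    ENNReal.toReal_ne_zero.2 ⟨mt Measure.measure_univ_eq_zero.1 hμ, measure_ne_top _ _⟩
  have h := tendsto_integral_simil_smul hy B hγpos hγ (integrable_const (μ := μ) (1 : ℝ))
  simp only [smul_eq_mul, mul_one, integral_const, Measure.real] at h
  exact (h.inv₀ hpos).smul (tendsto_integral_simil_smul hy B hγpos hγ hf)

/-- Corollary of Proposition 3 (DP direction): if the `s_γ`-SimFair violation vanishes
along a sequence of positive reals `γ_n → 0`, then the Demographic Parity violation is
zero. -/
theorem stmt11 {Ω : Type*} [MeasurableSpace Ω]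
    (P : Measure Ω) [IsProbabilityMeasure P]
    (K L : ℕ) (hK : 0 < K) (hL : 0 < L)
    (ytil : Ω → EuclideanSpace ℝ (Fin L)) (hmeas : Measurable ytil)
    (hbd : ∀ ω l, ytil ω l ∈ Set.Icc (0 : ℝ) 1)
    (a : Ω → Fin K) (ha : Measurable a)
    (hapos : ∀ k : Fin K, 0 < P {ω | a ω = k})
    (y : Ω → Finset (Fin L)) (hy : ∀ S : Finset (Fin L), MeasurableSet {ω | y ω = S})
    (yadv : Finset (Fin L)) (hyadv : yadv.Nonempty)
    (γ : ℕ → ℝ) (hγpos : ∀ n, 0 < γ n)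
    (hγ : Filter.Tendsto γ Filter.atTop (nhds 0))
    (hzero : ∀ n, fairViolation P ytil a (fun ω => simil (γ n) (y ω) yadv) = 0) :
    ∀ k : Fin K,
      ∫ ω, ytil ω ∂P
        = (P {ω | a ω = k}).toReal⁻¹ • (∫ ω in {ω | a ω = k}, ytil ω ∂P) := by
  intro k
  have hint : Integrable ytil P := by
    refine Integrable.of_eval_piLp fun l => ?_
    refine Integrable.of_bound (by fun_prop) 1 (.of_forall fun ω => ?_)
    rw [Real.norm_of_nonneg (hbd ω l).1]
    exact (hbd ω l).2
  have hne : P.restrict {ω | a ω = k} ≠ 0 :=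
    mt Measure.restrict_eq_zero.1 (hapos k).ne'
  have hγ0 := fun n => (hγpos n).le
  have h₁ := tendsto_simil_weighted_mean (IsProbabilityMeasure.ne_zero P) hy yadv hγ0 hγ hint
  have h₂ := tendsto_simil_weighted_mean hne hy yadv hγ0 hγ hint.restrict
  have heq : ∀ n, _ := fun n => sub_eq_zero.1 <| norm_eq_zero.1 <|
    (Finset.sum_eq_zero_iff_of_nonneg fun _ _ => norm_nonneg _).1 (hzero n) k (Finset.mem_univ k)
  simpa using tendsto_nhds_unique (h₁.congr heq) h₂
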